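/- (Local expansion of the Kronecker function.) Fix u ∉ Λ. Then the function z ↦ φ(z,u) − 1/z, defined for z near 0 with z ∉ Λ, extends holomorphically to z = 0; its value at z = 0 is E₁(u), and its derivative at z = 0 is (E₁(u)² − ℘(u))/2. Equivalently, φ(z,u) = 1/z + E₁(u) + z·(E₁(u)² − ℘(u))/2 + O(z²) as z → 0. -/

import Mathlib

open Complex Matrix Kronecker Finset Filter Topology

noncomputable section

/-- The lattice Λ = ℤ + τℤ. -/
def Lam (τ : ℂ) : Set ℂ := {z : ℂ | ∃ m n : ℤ, z = (m : ℂ) + (n : ℂ) * τ}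

/-- The first Jacobi theta function
ϑ(z) = −∑_{j∈ℤ} exp(πi(j+1/2)²τ + 2πi(j+1/2)(z+1/2)). -/
def theta (τ : ℂ) (z : ℂ) : ℂ :=
  -∑' j : ℤ, Complex.exp ((Real.pi : ℂ) * Complex.I * ((j : ℂ) + 1 / 2) ^ 2 * τ +
      2 * (Real.pi : ℂ) * Complex.I * ((j : ℂ) + 1 / 2) * (z + 1 / 2))

/-- The first Eisenstein function E₁(u) = ϑ′(u)/ϑ(u). -/
def E1 (τ : ℂ) (u : ℂ) : ℂ := deriv (theta τ) u / theta τ u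

/-- The Kronecker function φ(z,u) = ϑ′(0)·ϑ(z+u)/(ϑ(z)·ϑ(u)). -/
def phi (τ : ℂ) (z u : ℂ) : ℂ :=
  deriv (theta τ) 0 * theta τ (z + u) / (theta τ z * theta τ u)

/-- The second Eisenstein function E₂(u) = −E₁′(u). -/
def E2 (τ : ℂ) (u : ℂ) : ℂ := -deriv (E1 τ) u

/-- The Weierstrass ℘-function: ℘(u) = E₂(u) + (1/3)·ϑ‴(0)/ϑ′(0). -/
def wp (τ : ℂ) (u : ℂ) : ℂ :=
  E2 τ u + (1 / 3) * iteratedDeriv 3 (theta τ) 0 / deriv (theta τ) 0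

def qPhi (q x : ℂ) : ℂ := ∏' n : ℕ, (1 - q ^ n * x)

lemma qPhi_summable {q : ℂ} (hq : ‖q‖ < 1) (x : ℂ) : Summable fun n : ℕ => ‖-(q ^ n * x)‖ := by
  simp only [norm_neg, norm_mul, norm_pow]
  exact (summable_geometric_of_lt_one (norm_nonneg _) hq).mul_right _

lemma qPhi_mult {q : ℂ} (hq : ‖q‖ < 1) (x : ℂ) : Multipliable fun n : ℕ => (1 - q ^ n * x) := by
  simp only [sub_eq_add_neg]
  exact multipliable_one_add_of_summable (qPhi_summable hq x)

lemma qPhi_eq {q : ℂ} (hq : ‖q‖ < 1) (x : ℂ) : qPhi q x = (1 - x) * qPhi q (q * x) := by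
  have h : Multipliable fun n : ℕ => (1 - q ^ (n + 1) * x) := by
    have := qPhi_mult hq (q * x)
    simpa only [pow_succ, mul_assoc] using this
  have h2 := tprod_eq_zero_mul' (f := fun n : ℕ => 1 - q ^ n * x) h
  have h3 : qPhi q (q * x) = ∏' n : ℕ, (1 - q ^ (n + 1) * x) :=
    tprod_congr fun n => by rw [pow_succ, mul_assoc]
  rw [h3]
  simpa [qPhi] using h2

lemma qPhi_ne_zero {q : ℂ} (hq : ‖q‖ < 1) (x : ℂ) (h : ∀ n : ℕ, q ^ n * x ≠ 1) :
    qPhi q x ≠ 0 := by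
  unfold qPhi
  simp only [sub_eq_add_neg]
  refine tprod_one_add_ne_zero_of_summable (f := fun n : ℕ => -(q ^ n * x)) ?_ (qPhi_summable hq x)
  intro n hn
  exact h n (by linear_combination -hn)

lemma qPhi_diff {q : ℂ} (hq : ‖q‖ < 1) : Differentiable ℂ (qPhi q) := by
  have key : HasProdLocallyUniformlyOn (fun (n : ℕ) (x : ℂ) => 1 - q ^ n * x) (qPhi q)
      (Set.univ : Set ℂ) := by
    unfold qPhi
    simp_rw [sub_eq_add_neg]
    apply hasProdLocallyUniformlyOn_of_forall_compact isOpen_univ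
    intro K _ hcK
    obtain ⟨C, hC⟩ := hcK.isBounded.exists_norm_le
    refine Summable.hasProdUniformlyOn_nat_one_add (u := fun n => ‖q‖ ^ n * C) hcK
      ((summable_geometric_of_lt_one (norm_nonneg _) hq).mul_right _) ?_ ?_
    · refine .of_forall fun n x hx => ?_
      rw [norm_neg, norm_mul, norm_pow]
      gcongr
      exact hC x hx
    · intro n
      fun_prop
  rw [← differentiableOn_univ]
  refine key.differentiableOn (.of_forall fun s => ?_) isOpen_univ
  simpa [Finset.prod_fn] using DifferentiableOn.finsetProd (fun _ _ ↦ by fun_prop)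

/-- the product side -/
def pP (τ z : ℂ) : ℂ :=
  qPhi (cexp (2 * Real.pi * I * τ)) (cexp (2 * Real.pi * I * z)) *
  qPhi (cexp (2 * Real.pi * I * τ)) (cexp (2 * Real.pi * I * τ) * cexp (-(2 * Real.pi * I * z)))

lemma q_lt {τ : ℂ} (hτ : 0 < τ.im) : ‖cexp (2 * Real.pi * I * τ)‖ < 1 := by
  rw [norm_exp, Real.exp_lt_one_iff]
  simp
  positivity

lemma pP_diff {τ : ℂ} (hτ : 0 < τ.im) : Differentiable ℂ (pP τ) := by
  unfold pP
  have := qPhi_diff (q_lt hτ)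
  fun_prop

lemma pP_add_one (τ z : ℂ) : pP τ (z + 1) = pP τ z := by
  unfold pP
  have h1 : cexp (2 * Real.pi * I * (z + 1)) = cexp (2 * Real.pi * I * z) := by
    rw [mul_add, mul_one, exp_add, exp_two_pi_mul_I, mul_one]
  have h2 : cexp (-(2 * Real.pi * I * (z + 1))) = cexp (-(2 * Real.pi * I * z)) := by
    rw [exp_neg, h1, exp_neg]
  rw [h1, h2]

lemma pP_add_tau {τ : ℂ} (hτ : 0 < τ.im) (z : ℂ) :
    pP τ (z + τ) = -cexp (-(2 * Real.pi * I * z)) * pP τ z := by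
  unfold pP
  set q := cexp (2 * Real.pi * I * τ) with hq
  set w := cexp (2 * Real.pi * I * z) with hw
  have hw0 : w ≠ 0 := exp_ne_zero _
  have hq0 : q ≠ 0 := exp_ne_zero _
  have h1 : cexp (2 * Real.pi * I * (z + τ)) = q * w := by
    rw [mul_add, exp_add, mul_comm]
  rw [exp_neg, exp_neg, h1, ← hw]
  have e : q * (q * w)⁻¹ = w⁻¹ := by field_simp
  have hqn : ‖q‖ < 1 := q_lt hτ
  rw [e, qPhi_eq hqn w, qPhi_eq hqn w⁻¹]
  clear_value q w
  field_simp
  ring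

lemma pP_ne_zero {τ : ℂ} (hτ : 0 < τ.im) {z : ℂ} (hz : z ∉ Lam τ) : pP τ z ≠ 0 := by
  unfold pP
  refine mul_ne_zero (qPhi_ne_zero (q_lt hτ) _ ?_) (qPhi_ne_zero (q_lt hτ) _ ?_)
  · intro n hn
    rw [← exp_nat_mul, ← exp_add, exp_eq_one_iff] at hn
    obtain ⟨m, hm⟩ := hn
    refine hz ⟨m, -n, ?_⟩
    have h0 := two_pi_I_ne_zero
    apply mul_left_cancel₀ h0
    push_cast
    linear_combination hm
  · intro n hn
    rw [← exp_nat_mul, ← exp_add, ← exp_add, exp_eq_one_iff] at hn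
    obtain ⟨m, hm⟩ := hn
    refine hz ⟨-m, n + 1, ?_⟩
    have h0 := two_pi_I_ne_zero
    apply mul_left_cancel₀ h0
    push_cast
    linear_combination -hm

lemma pP_zero {τ : ℂ} (hτ : 0 < τ.im) : pP τ 0 = 0 := by
  unfold pP
  rw [qPhi_eq (q_lt hτ) (cexp (2 * Real.pi * I * 0))]
  simp

lemma pP_deriv {τ : ℂ} (hτ : 0 < τ.im) : deriv (pP τ) 0 ≠ 0 := by
  have hne : qPhi (cexp (2 * Real.pi * I * τ)) (cexp (2 * Real.pi * I * τ)) ≠ 0 := by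
    apply qPhi_ne_zero (q_lt hτ)
    intro n hn
    have := congrArg norm hn
    rw [← pow_succ, norm_pow, norm_one] at this
    exact absurd this (pow_lt_one₀ (norm_nonneg _) (q_lt hτ) (by omega)).ne
  have hd := qPhi_diff (q_lt hτ)
  have e : pP τ = fun z => (1 - cexp (2 * Real.pi * I * z)) *
      (qPhi (cexp (2 * Real.pi * I * τ)) (cexp (2 * Real.pi * I * τ) * cexp (2 * Real.pi * I * z)) *
      qPhi (cexp (2 * Real.pi * I * τ)) (cexp (2 * Real.pi * I * τ) * cexp (-(2 * Real.pi * I * z)))) := by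
    ext z
    unfold pP
    rw [qPhi_eq (q_lt hτ) (cexp (2 * Real.pi * I * z))]
    ring
  have h1 : HasDerivAt (fun z : ℂ => 1 - cexp (2 * Real.pi * I * z)) (-(2 * Real.pi * I)) 0 := by
    have := (((hasDerivAt_id (0:ℂ)).const_mul (2 * Real.pi * I)).cexp).const_sub 1
    simpa using this
  have h2 : DifferentiableAt ℂ (fun z : ℂ =>
      (qPhi (cexp (2 * Real.pi * I * τ)) (cexp (2 * Real.pi * I * τ) * cexp (2 * Real.pi * I * z)) *
      qPhi (cexp (2 * Real.pi * I * τ)) (cexp (2 * Real.pi * I * τ) * cexp (-(2 * Real.pi * I * z))))) 0 := by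
    fun_prop
  rw [e, (h1.fun_mul h2.hasDerivAt).deriv]
  simp [hne, Real.pi_ne_zero, I_ne_zero]

lemma theta_eq (τ z : ℂ) : theta τ z =
    -(cexp (Real.pi * I * τ / 4 + Real.pi * I * (z + 1 / 2)) *
      jacobiTheta₂ (z + 1 / 2 + τ / 2) τ) := by
  unfold theta jacobiTheta₂
  rw [← tsum_mul_left]
  congr 1
  refine tsum_congr fun n => ?_
  rw [jacobiTheta₂_term, ← exp_add]
  congr 1
  ring

lemma theta_diff {τ : ℂ} (hτ : 0 < τ.im) : Differentiable ℂ (theta τ) := by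
  have : theta τ = fun z => -(cexp (Real.pi * I * τ / 4 + Real.pi * I * (z + 1 / 2)) *
      jacobiTheta₂ (z + 1 / 2 + τ / 2) τ) := funext (theta_eq τ)
  rw [this]
  intro z
  have h := (differentiableAt_jacobiTheta₂_fst (z + 1 / 2 + τ / 2) hτ).comp z
    (f := fun z => z + 1 / 2 + τ / 2) (by fun_prop)
  have h' : DifferentiableAt ℂ (fun z => jacobiTheta₂ (z + 1 / 2 + τ / 2) τ) z := h
  fun_prop

lemma theta_neg (τ z : ℂ) : theta τ (-z) = -theta τ z := by
  unfold theta
  rw [← ((Equiv.neg ℤ).trans (Equiv.subRight (1 : ℤ))).tsum_eq (fun j : ℤ => cexp (_ + _ * (-z + 1 / 2))),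
    ← tsum_neg, ← tsum_neg, ← tsum_neg]
  refine tsum_congr fun n => ?_
  have : ∀ x : ℂ, -cexp x = cexp (x - (Real.pi * I) - (n : ℤ) * (2 * Real.pi * I)) := by
    intro x
    rw [exp_sub, exp_int_mul_two_pi_mul_I, exp_sub, exp_pi_mul_I, div_one, div_neg, div_one]
  rw [neg_inj, this]
  congr 1
  simp
  ring

lemma theta_zero (τ : ℂ) : theta τ 0 = 0 := by
  have := theta_neg τ 0
  rw [neg_zero] at this
  linear_combination this / 2

def th1 (τ z : ℂ) : ℂ := cexp (Real.pi * I * z) * theta τ z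

lemma th1_add_one (τ z : ℂ) : th1 τ (z + 1) = th1 τ z := by
  unfold th1
  rw [theta_eq, theta_eq, show z + 1 + 1 / 2 + τ / 2 = z + 1 / 2 + τ / 2 + 1 by ring,
    jacobiTheta₂_add_left, mul_neg, mul_neg, ← mul_assoc, ← mul_assoc, ← exp_add, ← exp_add]
  rw [show Real.pi * I * (z + 1) + (Real.pi * I * τ / 4 + Real.pi * I * (z + 1 + 1 / 2)) =
    Real.pi * I * z + (Real.pi * I * τ / 4 + Real.pi * I * (z + 1 / 2)) + 2 * Real.pi * I by ring,
    exp_add _ (2 * Real.pi * I), exp_two_pi_mul_I, mul_one]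

lemma th1_add_tau (τ z : ℂ) : th1 τ (z + τ) = -cexp (-(2 * Real.pi * I * z)) * th1 τ z := by
  unfold th1
  rw [theta_eq, theta_eq, show z + τ + 1 / 2 + τ / 2 = z + 1 / 2 + τ / 2 + τ by ring,
    jacobiTheta₂_add_left']
  have : ∀ x : ℂ, -cexp x = cexp (x - (Real.pi * I)) := by
    intro x
    rw [exp_sub, exp_pi_mul_I, div_neg, div_one]
  rw [this, mul_neg, mul_neg, mul_neg]
  simp only [← mul_assoc, ← exp_add]
  congr 3
  ring

lemma jt_ne {τ : ℂ} (hτ : 0 < τ.im) : ∃ z, jacobiTheta₂ z τ ≠ 0 := by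
  by_contra! h
  have hs : HasSum (fun n : ℤ => ∫ t in (0:ℝ)..1, jacobiTheta₂_term n t τ)
      (∫ t in (0:ℝ)..1, jacobiTheta₂ t τ) := by
    have hb := summable_pow_mul_jacobiTheta₂_term_bound 0 hτ 0
    refine intervalIntegral.hasSum_integral_of_dominated_convergence
      (fun n _ => Real.exp (-Real.pi * (τ.im * n ^ 2 - 2 * 0 * |(n:ℤ)|))) ?_ ?_ ?_ ?_ ?_
    · intro n
      apply Continuous.aestronglyMeasurable
      unfold jacobiTheta₂_term
      fun_prop
    · intro n
      refine .of_forall fun t _ => ?_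
      exact norm_jacobiTheta₂_term_le hτ (by simp) le_rfl n
    · refine .of_forall fun t _ => ?_
      simpa using hb
    · simp
    · exact .of_forall fun t _ => hasSum_jacobiTheta₂_term _ hτ
  simp only [h, intervalIntegral.integral_zero] at hs
  have h1 : ∀ n : ℤ, n ≠ 0 → ∫ t in (0:ℝ)..1, jacobiTheta₂_term n t τ = 0 := by
    intro n hn
    unfold jacobiTheta₂_term
    have hc : (2 * Real.pi * I * n : ℂ) ≠ 0 := by
      simp [Real.pi_ne_zero, I_ne_zero, hn]
    simp only [exp_add]
    rw [intervalIntegral.integral_mul_const, integral_exp_mul_complex hc]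
    have : cexp (2 * Real.pi * I * n) = 1 := by
      rw [mul_comm, exp_int_mul_two_pi_mul_I]
    simp [this]
  have h2 := (hasSum_single (0:ℤ) h1).unique hs
  simp [jacobiTheta₂_term] at h2

lemma th1_ne {τ : ℂ} (hτ : 0 < τ.im) : ∃ z, th1 τ z ≠ 0 := by
  obtain ⟨z, hz⟩ := jt_ne hτ
  refine ⟨z - 1 / 2 - τ / 2, ?_⟩
  unfold th1
  rw [theta_eq]
  refine mul_ne_zero (exp_ne_zero _) (neg_ne_zero.2 (mul_ne_zero (exp_ne_zero _) ?_))
  convert hz using 2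
  ring

lemma th1_diff {τ : ℂ} (hτ : 0 < τ.im) : Differentiable ℂ (th1 τ) := by
  unfold th1
  have := theta_diff hτ
  fun_prop

lemma lam_add_one (τ z : ℂ) : z + 1 ∈ Lam τ ↔ z ∈ Lam τ := by
  constructor
  · rintro ⟨m, n, h⟩
    exact ⟨m - 1, n, by push_cast; linear_combination h⟩
  · rintro ⟨m, n, h⟩
    exact ⟨m + 1, n, by push_cast; linear_combination h⟩

lemma lam_add_tau (τ z : ℂ) : z + τ ∈ Lam τ ↔ z ∈ Lam τ := by
  constructor
  · rintro ⟨m, n, h⟩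
    exact ⟨m, n - 1, by push_cast; linear_combination h⟩
  · rintro ⟨m, n, h⟩
    exact ⟨m, n + 1, by push_cast; linear_combination h⟩

lemma per_lattice {α : Type*} {τ : ℂ} {f : ℂ → α} (h1 : ∀ z, f (z + 1) = f z)
    (h2 : ∀ z, f (z + τ) = f z) (m n : ℤ) (z : ℂ) : f (z + (m + n * τ)) = f z := by
  have a : Function.Periodic f 1 := h1
  have b : Function.Periodic f τ := h2
  have a' := a.int_mul m
  have b' := b.int_mul n
  rw [mul_one] at a'
  exact (a'.add_period b') z

open Classical in
def fF (τ z : ℂ) : ℂ :=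
  if z ∈ Lam τ then deriv (th1 τ) 0 / deriv (pP τ) 0 else th1 τ z / pP τ z

lemma fF_add_one (τ z : ℂ) : fF τ (z + 1) = fF τ z := by
  unfold fF
  rw [th1_add_one, pP_add_one]
  classical
  by_cases h : z ∈ Lam τ
  · rw [if_pos h, if_pos ((lam_add_one τ z).2 h)]
  · rw [if_neg h, if_neg (fun h2 => h ((lam_add_one τ z).1 h2))]

lemma fF_add_tau {τ : ℂ} (hτ : 0 < τ.im) (z : ℂ) : fF τ (z + τ) = fF τ z := by
  unfold fF
  rw [th1_add_tau, pP_add_tau hτ, mul_div_mul_left _ _ (neg_ne_zero.2 (exp_ne_zero _))]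
  classical
  by_cases h : z ∈ Lam τ
  · rw [if_pos h, if_pos ((lam_add_tau τ z).2 h)]
  · rw [if_neg h, if_neg (fun h2 => h ((lam_add_tau τ z).1 h2))]

lemma zero_mem_lam (τ : ℂ) : (0 : ℂ) ∈ Lam τ := ⟨0, 0, by simp⟩

lemma th1_zero (τ : ℂ) : th1 τ 0 = 0 := by simp [th1, theta_zero]

lemma th1_lam {τ : ℂ} {z : ℂ} (hz : z ∈ Lam τ) : th1 τ z = 0 := by
  obtain ⟨m, n, rfl⟩ := hz
  have := per_lattice (τ := τ) (f := fun z => th1 τ z = 0)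
    (fun z => by rw [th1_add_one])
    (fun z => by rw [th1_add_tau]; simp [exp_ne_zero]) m n 0
  simp only [zero_add, th1_zero] at this
  simpa using this

lemma pP_lam {τ : ℂ} (hτ : 0 < τ.im) {z : ℂ} (hz : z ∈ Lam τ) : pP τ z = 0 := by
  obtain ⟨m, n, rfl⟩ := hz
  have := per_lattice (τ := τ) (f := fun z => pP τ z = 0)
    (fun z => by rw [pP_add_one])
    (fun z => by rw [pP_add_tau hτ]; simp [exp_ne_zero]) m n 0
  simp only [zero_add, pP_zero hτ] at this
  simpa using this

lemma dslope_diff {f : ℂ → ℂ} (hf : Differentiable ℂ f) : Differentiable ℂ (dslope f 0) := by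
  rw [← differentiableOn_univ] at hf ⊢
  exact (Complex.differentiableOn_dslope univ_mem).2 hf

lemma mul_dslope {f : ℂ → ℂ} (h0 : f 0 = 0) (z : ℂ) : f z = z * dslope f 0 z := by
  have := sub_smul_dslope f 0 z
  simp [h0] at this
  exact this.symm

lemma fF_diff {τ : ℂ} (hτ : 0 < τ.im) : Differentiable ℂ (fF τ) := by
  have h0 : DifferentiableAt ℂ (fF τ) 0 := by
    have hS := dslope_diff (pP_diff hτ)
    have hT := dslope_diff (th1_diff hτ)
    have hne : dslope (pP τ) 0 0 ≠ 0 := by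
      rw [dslope_same]; exact pP_deriv hτ
    have hev : ∀ᶠ z in 𝓝 (0:ℂ), dslope (pP τ) 0 z ≠ 0 :=
      hS.continuous.continuousAt.eventually_ne hne
    have hd : DifferentiableAt ℂ (fun z => dslope (th1 τ) 0 z / dslope (pP τ) 0 z) 0 :=
      (hT 0).fun_div (hS 0) hne
    refine hd.congr_of_eventuallyEq ?_
    filter_upwards [hev] with z hz
    by_cases h : z = 0
    · subst h
      simp [fF, zero_mem_lam]
    · have hP : pP τ z ≠ 0 := by
        rw [mul_dslope (pP_zero hτ)]
        exact mul_ne_zero h hz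
      have hl : z ∉ Lam τ := fun hl => hP (pP_lam hτ hl)
      rw [fF, if_neg hl, mul_dslope (pP_zero hτ), mul_dslope (th1_zero τ) z,
        mul_div_mul_left _ _ h]
  intro z
  by_cases hz : z ∈ Lam τ
  · obtain ⟨m, n, rfl⟩ := hz
    have e : fF τ = fun w => fF τ (w - (m + n * τ)) := by
      ext w
      have := per_lattice (fF_add_one τ) (fF_add_tau hτ) m n (w - (m + n * τ))
      rw [sub_add_cancel] at this
      exact this
    rw [e]
    refine DifferentiableAt.comp (g := fF τ) (f := fun w : ℂ => w - (m + n * τ)) _ ?_ (by fun_prop)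
    simpa using h0
  · have hP := pP_ne_zero hτ hz
    have hev : ∀ᶠ w in 𝓝 z, pP τ w ≠ 0 :=
      (pP_diff hτ).continuous.continuousAt.eventually_ne hP
    refine (((th1_diff hτ) z).fun_div ((pP_diff hτ) z) hP).congr_of_eventuallyEq ?_
    filter_upwards [hev] with w hw
    rw [fF, if_neg fun hl => hw (pP_lam hτ hl)]

lemma fF_const {τ : ℂ} (hτ : 0 < τ.im) (z w : ℂ) : fF τ z = fF τ w := by
  refine (fF_diff hτ).apply_eq_apply_of_bounded ?_ z w
  have hc : IsCompact ((fun p : ℝ × ℝ => fF τ ((p.1 : ℂ) + p.2 * τ)) ''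
      (Set.Icc 0 1 ×ˢ Set.Icc 0 1)) := by
    refine (isCompact_Icc.prod isCompact_Icc).image ?_
    have := (fF_diff hτ).continuous
    fun_prop
  refine hc.isBounded.subset ?_
  rintro _ ⟨z, rfl⟩
  set y := z.im / τ.im with hy
  set x := z.re - y * τ.re with hx
  have hz : z = (x : ℂ) + y * τ := by
    apply Complex.ext
    · simp [hx]
    · simp [hy, hτ.ne']
  refine ⟨(Int.fract x, Int.fract y), ⟨⟨Int.fract_nonneg _, (Int.fract_lt_one _).le⟩,
    ⟨Int.fract_nonneg _, (Int.fract_lt_one _).le⟩⟩, ?_⟩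
  have := per_lattice (fF_add_one τ) (fF_add_tau hτ) ⌊x⌋ ⌊y⌋
    ((Int.fract x : ℝ) + (Int.fract y : ℝ) * τ)
  simp only
  rw [← this]
  congr 1
  rw [hz]
  have hx' : (x : ℂ) = (⌊x⌋ : ℂ) + (Int.fract x : ℝ) := by
    exact_mod_cast (Int.floor_add_fract x).symm
  have hy' : (y : ℂ) = (⌊y⌋ : ℂ) + (Int.fract y : ℝ) := by
    exact_mod_cast (Int.floor_add_fract y).symm
  linear_combination -hx' - τ * hy'

lemma fF_ne {τ : ℂ} (hτ : 0 < τ.im) (w : ℂ) : fF τ w ≠ 0 := by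
  intro h
  obtain ⟨z, hz⟩ := th1_ne hτ
  have hl : z ∉ Lam τ := fun hl => hz (th1_lam hl)
  have := (fF_const hτ z w).trans h
  rw [fF, if_neg hl] at this
  exact (div_ne_zero hz (pP_ne_zero hτ hl)) this

lemma theta_ne {τ : ℂ} (hτ : 0 < τ.im) {u : ℂ} (hu : u ∉ Lam τ) : theta τ u ≠ 0 := by
  have := fF_ne hτ u
  rw [fF, if_neg hu] at this
  intro h
  simp [th1, h] at this

lemma theta_deriv_ne {τ : ℂ} (hτ : 0 < τ.im) : deriv (theta τ) 0 ≠ 0 := by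
  have := fF_ne hτ 0
  rw [fF, if_pos (zero_mem_lam τ)] at this
  intro h
  have hd : HasDerivAt (th1 τ) (deriv (fun z => cexp (Real.pi * I * z)) 0 * theta τ 0 +
      cexp (Real.pi * I * 0) * deriv (theta τ) 0) 0 := by
    have h1 : DifferentiableAt ℂ (fun z => cexp (Real.pi * I * z)) 0 := by fun_prop
    exact h1.hasDerivAt.fun_mul (theta_diff hτ 0).hasDerivAt
  rw [theta_zero, h] at hd
  simp [hd.deriv] at this

lemma mul_derivs {S : ℂ → ℂ} (hS : Differentiable ℂ S) :
    deriv (fun z => z * S z) = (fun z => S z + z * deriv S z) ∧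
    iteratedDeriv 3 (fun z => z * S z) 0 = 3 * deriv (deriv S) 0 := by
  have hS1 : Differentiable ℂ (deriv S) := hS.deriv
  have hS2 : Differentiable ℂ (deriv (deriv S)) := hS1.deriv
  have h1 : deriv (fun z => z * S z) = (fun z => S z + z * deriv S z) := by
    ext z
    rw [((hasDerivAt_id' z).fun_mul (hS z).hasDerivAt).deriv]
    ring
  have h2 : deriv (fun z => S z + z * deriv S z) =
      (fun z => 2 * deriv S z + z * deriv (deriv S) z) := by
    ext z
    rw [((hS z).hasDerivAt.fun_add ((hasDerivAt_id' z).fun_mul (hS1 z).hasDerivAt)).deriv]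
    ring
  refine ⟨h1, ?_⟩
  rw [iteratedDeriv_eq_iterate]
  simp only [Function.iterate_succ, Function.iterate_zero, Function.comp, id]
  rw [h1, h2, (((hS1 0).hasDerivAt.const_mul 2).fun_add
    ((hasDerivAt_id' (0:ℂ)).fun_mul (hS2 0).hasDerivAt)).deriv]
  ring

lemma expansion {T : ℂ → ℂ} (hT : Differentiable ℂ T) (hodd : ∀ z, T (-z) = -T z) (hT0 : T 0 = 0)
    (ha : deriv T 0 ≠ 0) {u : ℂ} (hu : T u ≠ 0) :
    ∃ g : ℂ → ℂ, AnalyticAt ℂ g 0 ∧ g 0 = deriv T u / T u ∧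
      deriv g 0 = ((deriv T u / T u) ^ 2 - (-deriv (fun z => deriv T z / T z) u +
        (1 / 3) * iteratedDeriv 3 T 0 / deriv T 0)) / 2 ∧
      ∀ z ≠ 0, g z = deriv T 0 * T (z + u) / (T z * T u) - 1 / z := by
  set S := dslope T 0 with hSdef
  have hS : Differentiable ℂ S := dslope_diff hT
  have hTS : T = fun z => z * S z := funext (mul_dslope hT0)
  have hS0 : S 0 = deriv T 0 := dslope_same _ _
  have h3 : iteratedDeriv 3 T 0 = 3 * deriv (deriv S) 0 := by
    rw [hTS]; exact (mul_derivs hS).2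
  have hev : ∀ z, S (-z) = S z := by
    intro z
    by_cases hz : z = 0
    · simp [hz]
    · have h1 := mul_dslope hT0 z
      have h2 := mul_dslope hT0 (-z)
      rw [hodd] at h2
      apply mul_left_cancel₀ hz
      linear_combination h1 + h2
  have hS1 : deriv S 0 = 0 := by
    have h := deriv_comp_neg S 0
    simp only [hev, neg_zero] at h
    linear_combination h / 2
  set a := deriv T 0 with ha'
  have hs : IsOpen {z | S z ≠ 0} := isOpen_ne_fun hS.continuous continuous_const
  have hs0 : {z | S z ≠ 0} ∈ 𝓝 (0:ℂ) := hs.mem_nhds (by simpa [hS0] using ha)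
  set N : ℂ → ℂ := fun z => a * T (z + u) / (S z * T u) with hN
  have hN0 : N 0 = 1 := by
    simp only [hN, hS0, zero_add]
    field_simp
  have hNd : DifferentiableOn ℂ N {z | S z ≠ 0} := by
    intro z hz
    have : DifferentiableAt ℂ N z := by
      refine DifferentiableAt.fun_div (by fun_prop) (by fun_prop) (mul_ne_zero hz hu)
    exact this.differentiableWithinAt
  have hgd := (Complex.differentiableOn_dslope hs0).2 hNd
  have hga : AnalyticAt ℂ (dslope N 0) 0 := hgd.analyticAt hs0
  set g := dslope N 0 with hg
  have hNg : ∀ z, N z = 1 + z * g z := by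
    intro z
    have := sub_smul_dslope N 0 z
    simp only [sub_zero, smul_eq_mul, hN0] at this
    linear_combination -this
  have hT1 : Differentiable ℂ (deriv T) := hT.deriv
  have hSd : Differentiable ℂ (deriv S) := hS.deriv
  have hid : ∀ z ∈ {z | S z ≠ 0}, S z * (1 + z * g z) = a / T u * T (z + u) := by
    intro z hz
    have hz' : S z ≠ 0 := hz
    rw [← hNg]
    simp only [hN]
    field_simp
  have hL : ∀ z ∈ {z | S z ≠ 0}, HasDerivAt (fun z => S z * (1 + z * g z))
      (deriv S z * (1 + z * g z) + S z * (g z + z * deriv g z)) z := by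
    intro z hz
    have hgz := (hgd.differentiableAt (hs.mem_nhds hz)).hasDerivAt
    convert! (hS z).hasDerivAt.fun_mul (((hasDerivAt_id' z).fun_mul hgz).const_add 1) using 1
    ring
  have hTu : ∀ z, HasDerivAt (fun z => T (z + u)) (deriv T (z + u)) z := fun z =>
    (hT (z + u)).hasDerivAt.comp_add_const z u
  have hT1u : ∀ z, HasDerivAt (fun z => deriv T (z + u)) (deriv (deriv T) (z + u)) z := fun z =>
    (hT1 (z + u)).hasDerivAt.comp_add_const z u
  have hid1 : ∀ z ∈ {z | S z ≠ 0}, deriv S z * (1 + z * g z) + S z * (g z + z * deriv g z) =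
      a / T u * deriv T (z + u) := by
    intro z hz
    refine (hL z hz).unique (((hTu z).const_mul (a / T u)).congr_of_eventuallyEq ?_)
    filter_upwards [hs.mem_nhds hz] with w hw using hid w hw
  have hg0 := hga.differentiableAt.hasDerivAt
  have hg1 := hga.deriv.differentiableAt.hasDerivAt
  have hi := hasDerivAt_id' (0:ℂ)
  have hid2 : deriv (deriv S) 0 + 2 * (deriv S 0 * g 0) + 2 * (S 0 * deriv g 0) =
      a / T u * deriv (deriv T) u := by
    have e1 := ((hSd 0).hasDerivAt.fun_mul ((hi.fun_mul hg0).const_add 1)).fun_add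
      ((hS 0).hasDerivAt.fun_mul (hg0.fun_add (hi.fun_mul hg1)))
    have e2 := (hT1u 0).const_mul (a / T u)
    have e3 := e1.unique (e2.congr_of_eventuallyEq (by
      filter_upwards [hs0] with w hw using hid1 w hw))
    rw [zero_add] at e3
    linear_combination e3
  have hm0 := hid1 0 (mem_of_mem_nhds hs0)
  rw [hS1, hS0, zero_add] at hm0
  rw [hS1, hS0] at hid2
  refine ⟨g, hga, ?_, ?_, ?_⟩
  · apply mul_left_cancel₀ ha
    linear_combination hm0
  · have hE : deriv (fun z => deriv T z / T z) u =
        (deriv (deriv T) u * T u - deriv T u * deriv T u) / T u ^ 2 :=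
      ((hT1 u).hasDerivAt.fun_div (hT u).hasDerivAt hu).deriv
    rw [hE, h3]
    field_simp at hid2 ⊢
    linear_combination T u * hid2
  · intro z hz
    have h1 := hNg z
    have h2 : T z = z * S z := mul_dslope hT0 z
    have h3 : g z = (N z - 1) / z := by
      rw [h1]; field_simp; ring
    rw [h3, h2]
    simp only [hN, div_eq_mul_inv, mul_inv]
    ring

/-- local expansion of the Kronecker function at z = 0: the function
z ↦ φ(z,u) − 1/z extends holomorphically to z = 0, with value E₁(u) and
derivative (E₁(u)² − ℘(u))/2 there; i.e.
φ(z,u) = 1/z + E₁(u) + z·(E₁(u)² − ℘(u))/2 + O(z²) as z → 0. -/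
theorem kronecker_local_expansion (τ : ℂ) (hτ : 0 < τ.im) (u : ℂ) (hu : u ∉ Lam τ) :
    ∃ g : ℂ → ℂ, AnalyticAt ℂ g 0 ∧ g 0 = E1 τ u ∧
      deriv g 0 = (E1 τ u ^ 2 - wp τ u) / 2 ∧
      ∀ᶠ z in 𝓝[≠] (0 : ℂ), g z = phi τ z u - 1 / z := by
  obtain ⟨g, h1, h2, h3, h4⟩ := expansion (theta_diff hτ) (theta_neg τ) (theta_zero τ)
    (theta_deriv_ne hτ) (theta_ne hτ hu)
  refine ⟨g, h1, h2, h3, ?_⟩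
  filter_upwards [self_mem_nhdsWithin] with z hz
  exact h4 z hz

end
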